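/- The grid graph P_m × P_n is neighborhood-prime if m ≡ 1 (mod 4) and n ≡ 3 (mod 4). -/

import Mathlib

namespace SimpleGraph

open scoped Classical in
/-- A graph of order `n` is *neighborhood-prime* if there is a bijective labeling of the
vertices by `{1, …, n}` such that for every vertex of degree at least 2, the gcd of the
labels appearing in its neighborhood is 1. -/
noncomputable def IsNeighborhoodPrime {V : Type*} [Fintype V] (G : SimpleGraph V) : Prop :=
  ∃ f : V ≃ Fin (Fintype.card V),
    ∀ v : V, 2 ≤ G.degree v →
      (G.neighborFinset v).gcd (fun u => (f u : ℕ) + 1) = 1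

/-- The grid graph `P_m × P_n`: the Cartesian (box) product of the path on `m` vertices
with the path on `n` vertices. -/
def gridGraph (m n : ℕ) : SimpleGraph (Fin m × Fin n) :=
  (SimpleGraph.pathGraph m).boxProd (SimpleGraph.pathGraph n)

end SimpleGraph

namespace SimpleGraph

theorem gridGraph_adj {m n : ℕ} {x y : Fin m × Fin n} :
    (gridGraph m n).Adj x y ↔
      ((x.1 : ℕ) + 1 = y.1 ∨ (y.1 : ℕ) + 1 = x.1) ∧ (x.2 : ℕ) = y.2 ∨
      ((x.2 : ℕ) + 1 = y.2 ∨ (y.2 : ℕ) + 1 = x.2) ∧ (x.1 : ℕ) = y.1 := by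
  simp only [gridGraph, boxProd_adj, pathGraph_adj, Fin.ext_iff]

/-- A labeling of the grid with `m` rows and `n` columns, `m` and `n` odd, by `{0, …, m * n - 1}`.
The odd columns of row `0` come first and its even columns last. In between, rows `2 * s + 1` and
`2 * s + 2` are traversed by two zigzags, one from right to left and one from left to right. -/
def gridLabel (m n i j : ℕ) : ℕ :=
  if i = 0 then
    if j % 2 = 1 then j / 2 else n / 2 + 2 * n * (m / 2) + j / 2
  else
    n / 2 + 2 * n * ((i - 1) / 2) + if (i + j) % 2 = 1 then n - 1 - j else n + j

theorem gridLabel_lt {m n i j : ℕ} (hm : m % 2 = 1) (hn : n % 2 = 1) (hi : i < m) (hj : j < n) :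
    gridLabel m n i j < m * n := by
  have hmn : m * n = 2 * n * (m / 2) + n := by
    conv_lhs => rw [show m = 2 * (m / 2) + 1 by omega]
    ring
  unfold gridLabel
  split_ifs with h0
  · omega
  · omega
  all_goals
    have := Nat.mul_le_mul_left (2 * n) (show (i - 1) / 2 + 1 ≤ m / 2 by omega)
    rw [mul_add] at this
    omega

theorem gridLabel_injective {m n i j i' j' : ℕ} (hm : m % 2 = 1) (hn : n % 2 = 1)
    (hi : i < m) (hj : j < n) (hi' : i' < m) (hj' : j' < n)
    (h : gridLabel m n i j = gridLabel m n i' j') : i = i' ∧ j = j' := by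
  have block : ∀ {s t : ℕ}, s < t → 2 * n * s + 2 * n ≤ 2 * n * t := fun hst => by
    simpa [mul_add] using Nat.mul_le_mul_left (2 * n) (Nat.succ_le_of_lt hst)
  have hs : i ≠ 0 → 2 * n * ((i - 1) / 2) + 2 * n ≤ 2 * n * (m / 2) := fun _ => block (by omega)
  have hs' : i' ≠ 0 → 2 * n * ((i' - 1) / 2) + 2 * n ≤ 2 * n * (m / 2) := fun _ =>
    block (by omega)
  unfold gridLabel at h
  by_cases h0 : i = 0
  · by_cases h0' : i' = 0
    · simp only [h0, h0', if_true] at h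
      split_ifs at h <;> omega
    · have := hs' h0'
      simp only [h0, h0', if_true, if_false] at h
      split_ifs at h <;> omega
  · by_cases h0' : i' = 0
    · have := hs h0
      simp only [h0, h0', if_true, if_false] at h
      split_ifs at h <;> omega
    · simp only [h0, h0', if_false] at h
      rcases lt_trichotomy ((i - 1) / 2) ((i' - 1) / 2) with hst | hst | hst
      · have := block hst
        split_ifs at h <;> omega
      · rw [hst] at h
        split_ifs at h <;> omega
      · have := block hst
        split_ifs at h <;> omega

/-- Within a pair of consecutive rows, the labels of a zigzag are consecutive. -/
theorem gridLabel_coprime_zigzag {m n i i' j : ℕ} (hi : i ≠ 0) (hi' : i' ≠ 0)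
    (hs : (i - 1) / 2 = (i' - 1) / 2) (hne : i ≠ i') (hj : j + 1 < n) :
    Nat.Coprime (gridLabel m n i j + 1) (gridLabel m n i' (j + 1) + 1) := by
  simp only [gridLabel, hi, hi', if_false, hs]
  split_ifs
  · rw [show n - 1 - j = n - 1 - (j + 1) + 1 by omega]
    simp [← add_assoc]
  · omega
  · omega
  · simp [← add_assoc]

theorem gridLabel_coprime_row_zero {m n j : ℕ} :
    Nat.Coprime (gridLabel m n 0 j + 1) (gridLabel m n 0 (j + 2) + 1) := by
  have : (j + 2) / 2 = j / 2 + 1 := by omega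
  simp only [gridLabel, if_true, Nat.add_mod_right, this]
  split_ifs <;> simp [← add_assoc]

theorem exists_gridLabel_coprime {m n : ℕ} (hm : m % 2 = 1) (hn : n % 2 = 1) (hn3 : 3 ≤ n)
    (v : Fin m × Fin n) {x y : Fin m × Fin n} (hx : (gridGraph m n).Adj v x)
    (hy : (gridGraph m n).Adj v y) (hxy : x ≠ y) :
    ∃ u w : Fin m × Fin n, (gridGraph m n).Adj v u ∧ (gridGraph m n).Adj v w ∧
      Nat.Coprime (gridLabel m n u.1 u.2 + 1) (gridLabel m n w.1 w.2 + 1) := by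
  obtain ⟨⟨i, hi⟩, ⟨j, hj⟩⟩ := v
  by_cases h0 : i = 0
  · subst h0
    by_cases hj0 : j = 0
    · subst hj0
      have hu : (gridGraph m n).Adj (⟨0, hi⟩, ⟨0, hj⟩) (⟨0, hi⟩, ⟨1, by omega⟩) := by
        simp [gridGraph_adj]
      exact ⟨_, _, hu, hu, by simp [gridLabel]⟩
    by_cases hjn : j + 1 < n
    · refine ⟨(⟨0, hi⟩, ⟨j - 1, by omega⟩), (⟨0, hi⟩, ⟨j + 1, hjn⟩), ?_, ?_, ?_⟩
      · simp [gridGraph_adj]; omega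
      · simp [gridGraph_adj]
      · have := gridLabel_coprime_row_zero (m := m) (n := n) (j := j - 1)
        rwa [show j - 1 + 2 = j + 1 by omega] at this
    · have hm1 : 1 < m := by
        obtain ⟨⟨a, ha⟩, ⟨b, hb⟩⟩ := x
        obtain ⟨⟨c, hc⟩, ⟨d, hd⟩⟩ := y
        simp only [gridGraph_adj] at hx hy
        simp only [ne_eq, Prod.mk.injEq, Fin.mk.injEq] at hxy
        omega
      refine ⟨(⟨0, hi⟩, ⟨j - 1, by omega⟩), (⟨1, hm1⟩, ⟨j, hj⟩), ?_, ?_, ?_⟩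
      · simp [gridGraph_adj]; omega
      · simp [gridGraph_adj]
      · have h1 : gridLabel m n 0 (j - 1) + 1 = n / 2 := by
          unfold gridLabel
          split_ifs <;> omega
        have h2 : gridLabel m n 1 j = n / 2 := by
          simp only [gridLabel, one_ne_zero, if_false, Nat.sub_self, Nat.zero_div, mul_zero]
          split_ifs <;> omega
        simp [h1, h2]
  · obtain ⟨i', hi', h0', hs, hadj⟩ : ∃ i' < m, i' ≠ 0 ∧ (i - 1) / 2 = (i' - 1) / 2 ∧
        (i + 1 = i' ∨ i' + 1 = i) := by
      rcases Nat.mod_two_eq_zero_or_one i with h | h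
      · exact ⟨i - 1, by omega, by omega, by omega, by omega⟩
      · exact ⟨i + 1, by omega, by omega, by omega, by omega⟩
    have hv : (gridGraph m n).Adj (⟨i, hi⟩, ⟨j, hj⟩) (⟨i', hi'⟩, ⟨j, hj⟩) := by
      simp [gridGraph_adj, hadj]
    have hne : i ≠ i' := by omega
    by_cases hjn : j + 1 < n
    · exact ⟨_, (⟨i, hi⟩, ⟨j + 1, hjn⟩), hv, by simp [gridGraph_adj],
        gridLabel_coprime_zigzag h0' h0 hs.symm hne.symm hjn⟩
    · obtain ⟨k, rfl⟩ : ∃ k, j = k + 1 := ⟨j - 1, by omega⟩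
      exact ⟨(⟨i, hi⟩, ⟨k, by omega⟩), _, by simp [gridGraph_adj], hv,
        gridLabel_coprime_zigzag h0 h0' hs hne hj⟩

theorem gridGraph_isNeighborhoodPrime_of_odd {m n : ℕ} (hm : m % 2 = 1) (hn : n % 2 = 1)
    (hn3 : 3 ≤ n) : (gridGraph m n).IsNeighborhoodPrime := by
  classical
  have hcard : Fintype.card (Fin m × Fin n) = m * n := by simp
  let g : Fin m × Fin n → Fin (Fintype.card (Fin m × Fin n)) := fun v =>
    ⟨gridLabel m n v.1 v.2, by rw [hcard]; exact gridLabel_lt hm hn v.1.2 v.2.2⟩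
  have hg : Function.Bijective g := by
    rw [Fintype.bijective_iff_injective_and_card]
    refine ⟨fun v w h => ?_, by simp⟩
    obtain ⟨h1, h2⟩ := gridLabel_injective hm hn v.1.2 v.2.2 w.1.2 w.2.2 (Fin.ext_iff.1 h)
    exact Prod.ext (Fin.ext h1) (Fin.ext h2)
  refine ⟨Equiv.ofBijective g hg, fun v hv => ?_⟩
  rw [← card_neighborFinset_eq_degree] at hv
  obtain ⟨x, hx, y, hy, hxy⟩ := Finset.one_lt_card.1 hv
  rw [mem_neighborFinset] at hx hy
  obtain ⟨u, w, hu, hw, huw⟩ := exists_gridLabel_coprime hm hn hn3 v hx hy hxy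
  refine Nat.eq_one_of_dvd_coprimes huw (Finset.gcd_dvd ?_) (Finset.gcd_dvd ?_)
  · rwa [mem_neighborFinset]
  · rwa [mem_neighborFinset]

end SimpleGraph

/-- The grid graph P_m × P_n is neighborhood-prime if m ≡ 1 (mod 4) and
n ≡ 3 (mod 4). -/
theorem gridGraph_one_three_mod_four_isNeighborhoodPrime (m n : ℕ)
    (hm : 1 ≤ m) (hn : 1 ≤ n) (h1 : m % 4 = 1) (h3 : n % 4 = 3) :
    (SimpleGraph.gridGraph m n).IsNeighborhoodPrime := by
  exact SimpleGraph.gridGraph_isNeighborhoodPrime_of_odd (by omega) (by omega) (by omega)
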